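/- arXiv:1307.8381 — 4 statements merged into one kernel-verified Lean document; each statement's English description precedes it below -/
import Mathlib

section
/- Let K be a nonempty open set with cl(K) ⊂ Ω and let ψ ∈ C_c^∞(Ω) satisfy ψ = 1 on K. Let δ > 0, let (λ, u) be a Robin eigenpair with parameter δ with ‖u‖_{H¹(Ω)} = 1, and suppose ∫_K u² dx ≥ η for some η > 0. Then λ ≥ − 4 ‖∇ψ‖²_{L^∞(Ω)} / η. -/
open MeasureTheory Filter Topology Bornology
open scoped RealInnerProductSpace

noncomputable section

/-- Euclidean space `ℝ^d`. -/
abbrev Euc (d : ℕ) := EuclideanSpace ℝ (Fin d)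

/-- Pointwise Laplacian of `u`. -/
def lapl {d : ℕ} (u : Euc d → ℝ) (x : Euc d) : ℝ :=
  ∑ i : Fin d, fderiv ℝ (fun y => fderiv ℝ u y (EuclideanSpace.single i 1)) x
    (EuclideanSpace.single i 1)

/-- Normal derivative `∂_ν u` with respect to the vector field `ν`. -/
def normalDeriv {d : ℕ} (ν : Euc d → Euc d) (u : Euc d → ℝ) (x : Euc d) : ℝ :=
  ⟪gradient u x, ν x⟫

/-- `(lam, u)` is a Robin eigenpair with parameter `δ` on `Ω`:
`u ∈ C²(cl Ω)` not identically zero, `Δu + lam u = 0` in `Ω` and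
`∂_ν u - (1/δ) u = 0` on `Γ = ∂Ω`. -/
def IsRobinPair {d : ℕ} (Ω : Set (Euc d)) (ν : Euc d → Euc d) (δ lam : ℝ)
    (u : Euc d → ℝ) : Prop :=
  ContDiffOn ℝ 2 u (closure Ω) ∧ (∃ x ∈ closure Ω, u x ≠ 0) ∧
    (∀ x ∈ Ω, lapl u x + lam * u x = 0) ∧
    (∀ x ∈ frontier Ω, normalDeriv ν u x - (1 / δ) * u x = 0)

/-- `(Λ, U)` is a Dirichlet eigenpair on `Ω`: `U ∈ C²(cl Ω)` not identically
zero, `ΔU + Λ U = 0` in `Ω` and `U = 0` on `Γ = ∂Ω`. -/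
def IsDirichletPair {d : ℕ} (Ω : Set (Euc d)) (Λ : ℝ) (U : Euc d → ℝ) : Prop :=
  ContDiffOn ℝ 2 U (closure Ω) ∧ (∃ x ∈ closure Ω, U x ≠ 0) ∧
    (∀ x ∈ Ω, lapl U x + Λ * U x = 0) ∧ (∀ x ∈ frontier Ω, U x = 0)

/-- `Λ` is a Dirichlet eigenvalue of `−Δ` on `Ω`. -/
def IsDirichletEigenvalue {d : ℕ} (Ω : Set (Euc d)) (Λ : ℝ) : Prop :=
  ∃ U, IsDirichletPair Ω Λ U

/-- Square of the `H¹(Ω)` norm: `∫_Ω |∇u|² + ∫_Ω |u|²`. -/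
def H1normSq {d : ℕ} (Ω : Set (Euc d)) (u : Euc d → ℝ) : ℝ :=
  (∫ x in Ω, ‖gradient u x‖ ^ 2) + ∫ x in Ω, (u x) ^ 2

/-- The integral of a directional derivative of a compactly supported `C¹` function vanishes. -/
theorem integral_fderiv_apply_eq_zero {E : Type*} [NormedAddCommGroup E] [NormedSpace ℝ E]
    [FiniteDimensional ℝ E] [MeasurableSpace E] [BorelSpace E] (μ : Measure E)
    [μ.IsAddHaarMeasure] {F : E → ℝ} (hF : ContDiff ℝ 1 F) (hFs : HasCompactSupport F) (v : E) :
    ∫ x, fderiv ℝ F x v ∂μ = 0 := by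
  have hint : Integrable (fun x => fderiv ℝ F x v) μ :=
    ((hF.continuous_fderiv one_ne_zero).clm_apply continuous_const).integrable_of_hasCompactSupport
      (hFs.fderiv_apply ℝ v)
  have h := integral_mul_fderiv_eq_neg_fderiv_mul_of_integrable (μ := μ) (𝕜 := ℝ)
    (f := fun _ => (1 : ℝ)) (g := F) (v := v) (by simp) (by simpa using hint)
    (by simpa using hF.continuous.integrable_of_hasCompactSupport hFs)
    (fun _ _ => differentiableAt_const _)
    (fun x _ => hF.differentiable one_ne_zero x)
  simpa using h

/-- A function that is smooth on an open set becomes globally smooth after multiplication by a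
smooth function supported in that set. -/
theorem ContDiff.mul_contDiffOn_of_tsupport_subset {E : Type*} [NormedAddCommGroup E]
    [NormedSpace ℝ E] {n : WithTop ℕ∞} {Ω : Set E} (hΩ : IsOpen Ω) {φ g : E → ℝ}
    (hφ : ContDiff ℝ n φ) (hφΩ : tsupport φ ⊆ Ω) (hg : ContDiffOn ℝ n g Ω) :
    ContDiff ℝ n (fun x => φ x * g x) := by
  rw [contDiff_iff_contDiffAt]
  intro x
  by_cases hx : x ∈ tsupport φ
  · exact hφ.contDiffAt.mul (hg.contDiffAt (hΩ.mem_nhds (hφΩ hx)))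
  · refine contDiffAt_const (c := (0 : ℝ)) |>.congr_of_eventuallyEq ?_
    filter_upwards [notMem_tsupport_iff_eventuallyEq.mp hx] with y hy
    simp [hy]

/-- Coordinates of the gradient are the partial derivatives. -/
theorem gradient_apply_eq_fderiv_single {d : ℕ} (f : Euc d → ℝ) (x : Euc d) (i : Fin d) :
    gradient f x i = fderiv ℝ f x (EuclideanSpace.single i 1) := by
  rw [← inner_gradient_left, EuclideanSpace.inner_single_right]
  simp

/-- The gradient of a `C¹` function is continuous. -/
theorem continuous_gradient {d : ℕ} {f : Euc d → ℝ} (hf : ContDiff ℝ 1 f) :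
    Continuous (gradient f) :=
  (InnerProductSpace.toDual ℝ (Euc d)).symm.continuous.comp (hf.continuous_fderiv one_ne_zero)

theorem tsupport_gradient_subset {d : ℕ} (f : Euc d → ℝ) :
    tsupport (gradient f) ⊆ tsupport f :=
  (closure_mono (Function.support_comp_subset (map_zero _) (fderiv ℝ f))).trans
    (tsupport_fderiv_subset ℝ)

/-- The divergence of `ψ² u ∇u`. -/
theorem sum_fderiv_cutoff_mul {d : ℕ} {ψ u : Euc d → ℝ} {x : Euc d} (hψ : DifferentiableAt ℝ ψ x)
    (hu : ContDiffAt ℝ 2 u x) :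
    ∑ i : Fin d, fderiv ℝ (fun y => ψ y ^ 2 * (u y * fderiv ℝ u y (EuclideanSpace.single i 1))) x
        (EuclideanSpace.single i 1) =
      ‖ψ x • gradient u x + u x • gradient ψ x‖ ^ 2 - ‖gradient ψ x‖ ^ 2 * u x ^ 2
        + ψ x ^ 2 * (u x * lapl u x) := by
  have hu1 : DifferentiableAt ℝ u x := hu.differentiableAt two_ne_zero
  have hdu : DifferentiableAt ℝ (fderiv ℝ u) x :=
    (hu.fderiv_right (m := 1) (by norm_num)).differentiableAt one_ne_zero
  rw [lapl, EuclideanSpace.real_norm_sq_eq, EuclideanSpace.real_norm_sq_eq, Finset.sum_mul,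
    Finset.mul_sum, Finset.mul_sum, ← Finset.sum_sub_distrib, ← Finset.sum_add_distrib]
  refine Finset.sum_congr rfl fun i _ => ?_
  have hpi : DifferentiableAt ℝ (fun y => fderiv ℝ u y (EuclideanSpace.single i 1)) x :=
    hdu.clm_apply (differentiableAt_const _)
  have h := (hψ.hasFDerivAt.pow 2).mul (hu1.hasFDerivAt.mul hpi.hasFDerivAt)
  rw [HasFDerivAt.fderiv (f := fun y => ψ y ^ 2 * (u y * fderiv ℝ u y (EuclideanSpace.single i 1)))
    h]
  simp only [PiLp.add_apply, PiLp.smul_apply, gradient_apply_eq_fderiv_single,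
    smul_eq_mul]
  simp
  ring

/-- Caccioppoli-type inequality: testing `Δu + lam u = 0` against `ψ² u`. -/
theorem integral_cutoff_nonneg {d : ℕ} {Ω : Set (Euc d)} (hΩ : IsOpen Ω) {ψ u : Euc d → ℝ}
    {lam : ℝ} (hψ : ContDiff ℝ 2 ψ) (hψs : HasCompactSupport ψ) (hψΩ : tsupport ψ ⊆ Ω)
    (hu : ContDiffOn ℝ 2 u Ω) (heq : ∀ x ∈ Ω, lapl u x + lam * u x = 0) :
    Integrable (fun x => ‖gradient ψ x‖ ^ 2 * u x ^ 2) ∧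
      Integrable (fun x => ψ x ^ 2 * u x ^ 2) ∧
      0 ≤ (∫ x, ‖gradient ψ x‖ ^ 2 * u x ^ 2) + lam * ∫ x, ψ x ^ 2 * u x ^ 2 := by
  have hψ1 : ContDiff ℝ 1 ψ := hψ.of_le (by norm_num)
  have hgs : tsupport (gradient ψ) ⊆ tsupport ψ := tsupport_gradient_subset ψ
  have hsq : tsupport (fun x => ψ x ^ 2) ⊆ tsupport ψ :=
    closure_mono fun x hx h => hx (by simp [h])
  have hgsq : tsupport (fun x => ‖gradient ψ x‖ ^ 2) ⊆ tsupport (gradient ψ) :=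
    closure_mono fun x hx h => hx (by simp [h])
  have hu0 : ContDiffOn ℝ 0 (fun x => u x ^ 2) Ω := (hu.pow 2).of_le (by simp)
  have hA : Integrable (fun x => ‖gradient ψ x‖ ^ 2 * u x ^ 2) := by
    refine Continuous.integrable_of_hasCompactSupport (ContDiff.continuous (𝕜 := ℝ) (n := 0)
      (ContDiff.mul_contDiffOn_of_tsupport_subset hΩ
        (contDiff_zero.mpr ((continuous_gradient hψ1).norm.pow 2))
        (hgsq.trans (hgs.trans hψΩ)) hu0)) ?_
    exact HasCompactSupport.mul_right (f := fun x => ‖gradient ψ x‖ ^ 2)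
      (hψs.of_isClosed_subset (isClosed_tsupport _) (hgsq.trans hgs))
  have hsqs : HasCompactSupport (fun x => ψ x ^ 2) :=
    hψs.of_isClosed_subset (isClosed_tsupport _) hsq
  have hB : Integrable (fun x => ψ x ^ 2 * u x ^ 2) :=
    Continuous.integrable_of_hasCompactSupport (ContDiff.continuous (𝕜 := ℝ) (n := 0)
      (ContDiff.mul_contDiffOn_of_tsupport_subset hΩ ((hψ.pow 2).of_le (by simp))
        (hsq.trans hψΩ) hu0)) hsqs.mul_right
  refine ⟨hA, hB, ?_⟩
  let F : Fin d → Euc d → ℝ := fun i y =>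
    ψ y ^ 2 * (u y * fderiv ℝ u y (EuclideanSpace.single i 1))
  have hFd (i : Fin d) : ContDiff ℝ 1 (F i) := by
    refine ContDiff.mul_contDiffOn_of_tsupport_subset hΩ (hψ1.pow 2) (hsq.trans hψΩ) ?_
    exact (hu.of_le (by norm_num)).mul
      ((hu.fderiv_of_isOpen hΩ (m := 1) (by norm_num)).clm_apply contDiffOn_const)
  have hFs (i : Fin d) : HasCompactSupport (F i) := hsqs.mul_right
  have hFi (i : Fin d) :
      Integrable (fun x => fderiv ℝ (F i) x (EuclideanSpace.single i 1)) :=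
    (((hFd i).continuous_fderiv one_ne_zero).clm_apply
      continuous_const).integrable_of_hasCompactSupport ((hFs i).fderiv_apply ℝ _)
  have hzero : ∫ x, ∑ i, fderiv ℝ (F i) x (EuclideanSpace.single i 1) = 0 := by
    rw [integral_finsetSum _ fun i _ => hFi i]
    exact Finset.sum_eq_zero fun i _ => integral_fderiv_apply_eq_zero _ (hFd i) (hFs i) _
  have hle : 0 ≤ ∫ x, (‖gradient ψ x‖ ^ 2 * u x ^ 2 + lam * (ψ x ^ 2 * u x ^ 2))
      + ∑ i, fderiv ℝ (F i) x (EuclideanSpace.single i 1) := by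
    refine integral_nonneg fun x => ?_
    by_cases hx : x ∈ tsupport ψ
    · have hxΩ := hψΩ hx
      have hsum := sum_fderiv_cutoff_mul (hψ1.differentiable one_ne_zero x)
        (hu.contDiffAt (hΩ.mem_nhds hxΩ))
      have hl : lapl u x = -(lam * u x) := by linarith [heq x hxΩ]
      rw [hl] at hsum
      simp only [F, Pi.zero_apply, hsum]
      nlinarith [sq_nonneg ‖ψ x • gradient u x + u x • gradient ψ x‖]
    · have h0 : ψ x = 0 := image_eq_zero_of_notMem_tsupport hx
      have h1 : gradient ψ x = 0 := image_eq_zero_of_notMem_tsupport fun h => hx (hgs h)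
      have h2 (i : Fin d) : fderiv ℝ (F i) x = 0 :=
        image_eq_zero_of_notMem_tsupport fun h =>
          hx (hsq (tsupport_mul_subset_left (tsupport_fderiv_subset ℝ h)))
      simp [h0, h1, h2]
  have hAB : Integrable (fun x => ‖gradient ψ x‖ ^ 2 * u x ^ 2 + lam * (ψ x ^ 2 * u x ^ 2)) :=
    hA.add (hB.const_mul lam)
  rw [integral_add hAB (integrable_finsetSum _ fun i _ => hFi i), hzero,
    integral_add hA (hB.const_mul lam), integral_const_mul] at hle
  simpa using hle

/-- if `(lam, u)` is a Robin eigenpair with parameter `δ`,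
`‖u‖_{H¹(Ω)} = 1` and `∫_K u² ≥ η` on a nonempty open set `K` compactly included
in `Ω`, then `lam ≥ -4 ‖∇ψ‖²_{L^∞(Ω)} / η` for any cutoff `ψ ∈ C_c^∞(Ω)` with
`ψ = 1` on `K`. -/
theorem robin_eigenvalue_lower_bound
    {d : ℕ} (hd : 2 ≤ d) (Ω : Set (Euc d))
    (hΩopen : IsOpen Ω) (hΩbdd : IsBounded Ω) (hΩconn : IsConnected Ω)
    (ν : Euc d → Euc d)
    (K : Set (Euc d)) (hKopen : IsOpen K) (hKne : K.Nonempty)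
    (hKsub : closure K ⊆ Ω)
    (ψ : Euc d → ℝ) (hψreg : ContDiff ℝ (⊤ : ℕ∞) ψ) (hψsupp : HasCompactSupport ψ)
    (hψΩ : tsupport ψ ⊆ Ω) (hψK : ∀ x ∈ K, ψ x = 1)
    (δ lam : ℝ) (hδ : 0 < δ)
    (u : Euc d → ℝ) (hRobin : IsRobinPair Ω ν δ lam u)
    (hnorm : H1normSq Ω u = 1)
    (η : ℝ) (hη : 0 < η) (hK : η ≤ ∫ x in K, (u x) ^ 2) :
    -(4 * (⨆ x : Euc d, ‖gradient ψ x‖) ^ 2 / η) ≤ lam := by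
  obtain ⟨hu, -, heq, -⟩ := hRobin
  have hψ2 : ContDiff ℝ 2 ψ := hψreg.of_le (WithTop.coe_le_coe.mpr le_top)
  have hψ1 : ContDiff ℝ 1 ψ := hψ2.of_le (by norm_num)
  obtain ⟨hA, hB, hmain⟩ := integral_cutoff_nonneg hΩopen hψ2 hψsupp hψΩ
    (hu.mono subset_closure) heq
  set M := ⨆ x : Euc d, ‖gradient ψ x‖ with hM
  have hgs : tsupport (gradient ψ) ⊆ tsupport ψ := tsupport_gradient_subset ψ
  have hMle (x : Euc d) : ‖gradient ψ x‖ ≤ M :=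
    le_ciSup ((continuous_gradient hψ1).norm.bddAbove_range_of_hasCompactSupport
      (HasCompactSupport.norm (hψsupp.of_isClosed_subset (isClosed_tsupport _) hgs))) x
  have hu2 : IntegrableOn (fun x => u x ^ 2) Ω :=
    ((hu.continuousOn.pow 2).integrableOn_compact hΩbdd.isCompact_closure).mono_set subset_closure
  have hu2le : ∫ x in Ω, u x ^ 2 ≤ 1 := by
    have : 0 ≤ ∫ x in Ω, ‖gradient u x‖ ^ 2 := integral_nonneg fun x => sq_nonneg _
    unfold H1normSq at hnorm
    linarith
  have hgrad : ∫ x, ‖gradient ψ x‖ ^ 2 * u x ^ 2 ≤ M ^ 2 := calc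
    _ = ∫ x in Ω, ‖gradient ψ x‖ ^ 2 * u x ^ 2 := by
      refine (setIntegral_eq_integral_of_forall_compl_eq_zero fun x hx => ?_).symm
      have : gradient ψ x = 0 := image_eq_zero_of_notMem_tsupport fun h => hx (hψΩ (hgs h))
      simp [this]
    _ ≤ ∫ x in Ω, M ^ 2 * u x ^ 2 :=
      integral_mono hA.integrableOn (hu2.const_mul _) fun x =>
        mul_le_mul_of_nonneg_right (pow_le_pow_left₀ (norm_nonneg _) (hMle x) 2) (sq_nonneg _)
    _ = M ^ 2 * ∫ x in Ω, u x ^ 2 := integral_const_mul _ _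
    _ ≤ M ^ 2 := mul_le_of_le_one_right (sq_nonneg _) hu2le
  have hmass : η ≤ ∫ x, ψ x ^ 2 * u x ^ 2 := calc
    η ≤ ∫ x in K, u x ^ 2 := hK
    _ = ∫ x in K, ψ x ^ 2 * u x ^ 2 :=
      setIntegral_congr_fun hKopen.measurableSet fun x hx => by simp [hψK x hx]
    _ ≤ ∫ x, ψ x ^ 2 * u x ^ 2 :=
      setIntegral_le_integral hB (Eventually.of_forall fun x => by positivity)
  rcases le_or_gt 0 lam with hl | hl
  · exact (neg_nonpos.mpr (by positivity)).trans hl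
  · rw [neg_le, le_div_iff₀ hη]
    nlinarith [mul_le_mul_of_nonneg_left hmass (neg_nonneg.mpr hl.le), sq_nonneg M]
end
end

section
/- There exist positive constants α, θ and δ₀ such that for every δ with 0 < δ ≤ δ₀ and every u ∈ C¹(cl(Ω)): ∫_Ω |∇u|² dx − (1/δ) ∫_Γ |u|² dσ + (α/δ²) ∫_Ω |u|² dx ≥ θ ( ∫_Ω |∇u|² dx + (1/δ²) ∫_Ω |u|² dx ). -/
open MeasureTheory Filter Topology Bornology
open scoped RealInnerProductSpace

noncomputable section

/-- Absorbing a trace-type bound `T ≤ C (√A √B + B)` by Young's inequality. -/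
lemma shifted_form_lower_bound {A B T C δ : ℝ} (hC : 0 ≤ C) (hδ : 0 < δ) (hδ1 : δ ≤ 1)
    (hA : 0 ≤ A) (hB : 0 ≤ B) (hT : T ≤ C * (√A * √B + B)) :
    1 / 2 * (A + 1 / δ ^ 2 * B) ≤
      A - 1 / δ * T + (1 / 2 + C ^ 2 / 2 + C) / δ ^ 2 * B := by
  obtain ⟨a, ha⟩ : ∃ a, a = √A := ⟨_, rfl⟩
  obtain ⟨b, hb⟩ : ∃ b, b = √B / δ := ⟨_, rfl⟩
  have hbδ : √B = δ * b := by rw [hb]; field_simp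
  have hAa : A = a ^ 2 := by rw [ha, Real.sq_sqrt hA]
  have hBb : B = δ ^ 2 * b ^ 2 := by rw [← mul_pow, ← hbδ, Real.sq_sqrt hB]
  have hTab : 1 / δ * T ≤ C * (a * b) + C * δ * b ^ 2 := by
    calc 1 / δ * T ≤ 1 / δ * (C * (√A * √B + B)) := by gcongr
      _ = 1 / δ * (C * (a * (δ * b) + δ ^ 2 * b ^ 2)) := by rw [← ha, hbδ, ← hBb]
      _ = C * (a * b) + C * δ * b ^ 2 := by field_simp
  have hδb : C * δ * b ^ 2 ≤ C * b ^ 2 := by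
    gcongr
    exact mul_le_of_le_one_right hC hδ1
  have hBδ (c : ℝ) : c / δ ^ 2 * B = c * b ^ 2 := by rw [hBb]; field_simp
  rw [hBδ, hBδ, hAa]
  nlinarith [sq_nonneg (a - C * b)]

/-- Lemma `para` of the paper: there are `α, θ, δ₀ > 0` with
`∫_Ω|∇u|² − (1/δ)∫_Γ|u|²dσ + (α/δ²)∫_Ω|u|² ≥ θ(∫_Ω|∇u|² + (1/δ²)∫_Ω|u|²)`
for all `0 < δ ≤ δ₀` and all `u ∈ C¹(cl Ω)`. -/
theorem coercivity_of_shifted_robin_form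
    {d : ℕ} (hd : 2 ≤ d) (Ω : Set (Euc d))
    (hΩopen : IsOpen Ω) (hΩbdd : IsBounded Ω) (hΩconn : IsConnected Ω)
    (σ : Measure (Euc d))
    (CΓ : ℝ) (hCΓ : 0 < CΓ)
    (htrace : ∀ u : Euc d → ℝ, ContDiffOn ℝ 1 u (closure Ω) →
      (∫ x in frontier Ω, (u x) ^ 2 ∂σ) ≤
        CΓ * (Real.sqrt (∫ x in Ω, ‖gradient u x‖ ^ 2) *
              Real.sqrt (∫ x in Ω, (u x) ^ 2) + ∫ x in Ω, (u x) ^ 2)) :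
    ∃ α θ δ₀ : ℝ, 0 < α ∧ 0 < θ ∧ 0 < δ₀ ∧
      ∀ δ : ℝ, 0 < δ → δ ≤ δ₀ → ∀ u : Euc d → ℝ, ContDiffOn ℝ 1 u (closure Ω) →
        θ * ((∫ x in Ω, ‖gradient u x‖ ^ 2) + (1 / δ ^ 2) * ∫ x in Ω, (u x) ^ 2) ≤
          (∫ x in Ω, ‖gradient u x‖ ^ 2) - (1 / δ) * (∫ x in frontier Ω, (u x) ^ 2 ∂σ)
            + (α / δ ^ 2) * ∫ x in Ω, (u x) ^ 2 := by
  refine ⟨1 / 2 + CΓ ^ 2 / 2 + CΓ, 1 / 2, 1, by positivity, by norm_num, one_pos, ?_⟩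
  intro δ hδ hδ1 u hu
  have hA : 0 ≤ ∫ x in Ω, ‖gradient u x‖ ^ 2 := integral_nonneg fun x => by positivity
  have hB : 0 ≤ ∫ x in Ω, (u x) ^ 2 := integral_nonneg fun x => by positivity
  exact shifted_form_lower_bound hCΓ.le hδ hδ1 hA hB (htrace u hu)
end
end

section
/- Let α > 0. There exists C > 0, independent of δ, such that for every δ with 0 < δ ≤ 1 and all u, v ∈ C¹(cl(Ω)), the bilinear form a^δ(u, v) := ∫_Ω ∇u·∇v dx − (1/δ) ∫_Γ u v dσ + (α/δ²) ∫_Ω u v dx satisfies |a^δ(u, v)| ≤ C ‖u‖_{H¹_δ(Ω)} ‖v‖_{H¹_δ(Ω)} (i.e. the operator A^δ representing a^δ on the Hilbert space H¹ equipped with the ‖·‖_{H¹_δ(Ω)} norm is bounded uniformly in δ). -/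
open MeasureTheory Filter Topology Bornology
open scoped RealInnerProductSpace

noncomputable section

/-- The square of the weighted norm `‖u‖_{H¹_δ(Ω)}`. -/
def weightedNormSq {d : ℕ} (Ω : Set (Euc d)) (δ : ℝ) (u : Euc d → ℝ) : ℝ :=
  (∫ x in Ω, ‖gradient u x‖ ^ 2) + (1 / δ ^ 2) * ∫ x in Ω, (u x) ^ 2

/-- The regularised quadratic form `s² a² + b² / s² + ε`. -/
def coneDenom (ε s a b : ℝ) : ℝ := s ^ 2 * a ^ 2 + b ^ 2 / s ^ 2 + ε

/-- A smooth function of `(a, b)`, nearly homogeneous of degree one, whose square is comparable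
to `|a b|` on the cone `|b| ≈ s² |a|` and which decays away from that cone. -/
def coneFun (ε s a b : ℝ) : ℝ := s * a ^ 3 * b ^ 2 / coneDenom ε s a b ^ 2

/-- A weight concentrated on the cone `|b| ≈ s² |a|`. -/
def coneWeight (ε s a b : ℝ) : ℝ := a ^ 2 * b ^ 2 / coneDenom ε s a b ^ 2

lemma coneDenom_pos {ε s : ℝ} (hε : 0 < ε) (a b : ℝ) : 0 < coneDenom ε s a b := by
  unfold coneDenom; positivity

lemma coneWeight_nonneg (ε s a b : ℝ) : 0 ≤ coneWeight ε s a b := by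
  unfold coneWeight; positivity

lemma sq_mul_sq_le_coneDenom {ε s : ℝ} (hε : 0 < ε) (a b : ℝ) :
    s ^ 2 * a ^ 2 ≤ coneDenom ε s a b := by
  have : 0 ≤ b ^ 2 / s ^ 2 := by positivity
  unfold coneDenom; linarith

lemma sq_div_sq_le_coneDenom {ε s : ℝ} (hε : 0 < ε) (a b : ℝ) :
    b ^ 2 / s ^ 2 ≤ coneDenom ε s a b := by
  have : 0 ≤ s ^ 2 * a ^ 2 := by positivity
  unfold coneDenom; linarith

lemma sq_mul_sq_le_coneDenom_sq {ε s : ℝ} (hε : 0 < ε) (hs : 0 < s) (a b : ℝ) :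
    a ^ 2 * b ^ 2 ≤ coneDenom ε s a b ^ 2 := by
  have h := mul_le_mul (sq_mul_sq_le_coneDenom (s := s) hε a b)
    (sq_div_sq_le_coneDenom (s := s) hε a b) (by positivity) (coneDenom_pos hε a b).le
  calc a ^ 2 * b ^ 2 = s ^ 2 * a ^ 2 * (b ^ 2 / s ^ 2) := by field_simp
    _ ≤ _ := by rw [sq (coneDenom ε s a b)]; exact h

lemma coneWeight_le_one {ε s : ℝ} (hε : 0 < ε) (hs : 0 < s) (a b : ℝ) :
    coneWeight ε s a b ≤ 1 :=
  div_le_one_of_le₀ (sq_mul_sq_le_coneDenom_sq hε hs a b) (sq_nonneg _)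

lemma coneFun_sq_le_mul_sq {ε s : ℝ} (hε : 0 < ε) (hs : 0 < s) (a b : ℝ) :
    coneFun ε s a b ^ 2 ≤ s ^ 2 * (coneWeight ε s a b * a ^ 2) := by
  have h1 := coneWeight_le_one hε hs a b
  have h0 := coneWeight_nonneg ε s a b
  have hR := coneDenom_pos (s := s) hε a b
  have : coneFun ε s a b ^ 2 =
      s ^ 2 * (coneWeight ε s a b * a ^ 2) * coneWeight ε s a b := by
    unfold coneFun coneWeight; field_simp
  rw [this]
  exact mul_le_of_le_one_right (by positivity) h1

lemma coneFun_sq_le_div_sq {ε s : ℝ} (hε : 0 < ε) (hs : 0 < s) (a b : ℝ) :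
    coneFun ε s a b ^ 2 ≤ (coneWeight ε s a b * b ^ 2) / s ^ 2 := by
  have h0 := coneWeight_nonneg ε s a b
  have hR := coneDenom_pos (s := s) hε a b
  have h1 : s ^ 2 * a ^ 2 / coneDenom ε s a b ≤ 1 :=
    div_le_one_of_le₀ (sq_mul_sq_le_coneDenom hε a b) hR.le
  have : coneFun ε s a b ^ 2 = (coneWeight ε s a b * b ^ 2) / s ^ 2 *
      (s ^ 2 * a ^ 2 / coneDenom ε s a b) ^ 2 := by
    unfold coneFun coneWeight; field_simp
  rw [this]
  exact mul_le_of_le_one_right (by positivity) (pow_le_one₀ (by positivity) h1)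

lemma coneFun_sq_le_abs_mul {ε s : ℝ} (hε : 0 < ε) (hs : 0 < s) (a b : ℝ) :
    coneFun ε s a b ^ 2 ≤ |a * b| := by
  have h1 := coneFun_sq_le_mul_sq hε hs a b
  have h2 := coneFun_sq_le_div_sq hε hs a b
  have hW := coneWeight_le_one hε hs a b
  have h0 := coneWeight_nonneg ε s a b
  apply abs_le_of_sq_le_sq' _ (abs_nonneg _) |>.2
  calc (coneFun ε s a b ^ 2) ^ 2
      = coneFun ε s a b ^ 2 * coneFun ε s a b ^ 2 := by ring
    _ ≤ s ^ 2 * (coneWeight ε s a b * a ^ 2) * ((coneWeight ε s a b * b ^ 2) / s ^ 2) :=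
        mul_le_mul h1 h2 (sq_nonneg _) (by positivity)
    _ = coneWeight ε s a b ^ 2 * (a * b) ^ 2 := by field_simp
    _ ≤ |a * b| ^ 2 := by
        rw [sq_abs]
        exact mul_le_of_le_one_left (sq_nonneg _) (pow_le_one₀ h0 hW)

lemma abs_mul_le_coneFun_sq {ε s a b : ℝ} (hs : 0 < s) (hab : 0 < |a * b|)
    (hε : ε ≤ |a * b|) (hε' : 0 < ε) (h1 : s ^ 2 * |a| ≤ |b|) (h2 : |b| ≤ 4 * (s ^ 2 * |a|)) :
    |a * b| / 5184 ≤ coneFun ε s a b ^ 2 := by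
  have hR := coneDenom_pos (s := s) hε' a b
  rw [abs_mul] at *
  have hRle : coneDenom ε s a b ≤ 6 * (|a| * |b|) := by
    have e1 : s ^ 2 * a ^ 2 ≤ |a| * |b| := by
      rw [← sq_abs a]; nlinarith [abs_nonneg a]
    have e2 : b ^ 2 / s ^ 2 ≤ 4 * (|a| * |b|) := by
      rw [← sq_abs b, div_le_iff₀ (by positivity)]; nlinarith [abs_nonneg b]
    unfold coneDenom; linarith
  have h3 : |a| * |b| / 4 ≤ s ^ 2 * a ^ 2 := by
    rw [← sq_abs a]; nlinarith [abs_nonneg a]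
  have hf : coneFun ε s a b ^ 2 =
      s ^ 2 * a ^ 2 * (|a| * |b|) ^ 4 / coneDenom ε s a b ^ 4 := by
    have : (|a| * |b|) ^ 4 = a ^ 4 * b ^ 4 := by
      rw [← abs_mul, ← mul_pow]; exact Even.pow_abs (by decide) _
    rw [this]; unfold coneFun; field_simp
  have h4 : coneDenom ε s a b ^ 4 ≤ (6 * (|a| * |b|)) ^ 4 := pow_le_pow_left₀ hR.le hRle 4
  rw [hf, le_div_iff₀ (by positivity)]
  calc |a| * |b| / 5184 * coneDenom ε s a b ^ 4
      ≤ |a| * |b| / 5184 * (6 * (|a| * |b|)) ^ 4 := by gcongr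
    _ = |a| * |b| / 4 * (|a| * |b|) ^ 4 := by ring
    _ ≤ _ := by gcongr

/-- The weights attached to the dyadic parameters `s = 2 ^ (i - n)` have bounded overlap. -/
lemma sum_coneWeight_le {ε : ℝ} (hε : 0 < ε) (n : ℤ) (N : ℕ) (a b : ℝ) :
    ∑ i ∈ Finset.range N, coneWeight ε ((2 : ℝ) ^ ((i : ℤ) - n)) a b ≤ 2 := by
  rcases eq_or_ne (a * b) 0 with h | h
  · have h' : ∀ s, coneWeight ε s a b = 0 := fun s => by
      unfold coneWeight; rw [← mul_pow, h]; simp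
    simp [h']
  · have ha : a ≠ 0 := left_ne_zero_of_mul h
    have hb : b ≠ 0 := right_ne_zero_of_mul h
    set S : ℕ → ℝ := fun i => (2 : ℝ) ^ ((i : ℤ) - n) with hS
    have hSpos : ∀ i, 0 < S i := fun i => by positivity
    have hSsucc : ∀ i, S (i + 1) = 2 * S i := fun i => by
      simp only [hS]
      rw [← zpow_one_add₀ (by norm_num)]; congr 1; push_cast; ring
    set ψ : ℕ → ℝ := fun i => S i ^ 4 * a ^ 2 / (S i ^ 4 * a ^ 2 + b ^ 2) with hψ
    have hψ0 : ∀ i, 0 ≤ ψ i := fun i => by positivity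
    have hψ1 : ∀ i, ψ i ≤ 1 := fun i =>
      div_le_one_of_le₀ (le_add_of_nonneg_right (sq_nonneg _)) (by positivity)
    have key : ∀ i, coneWeight ε (S i) a b ≤ 2 * (ψ (i + 1) - ψ i) := fun i => by
      have hs := hSpos i
      have e1 : coneWeight ε (S i) a b ≤
          S i ^ 4 * a ^ 2 * b ^ 2 / (S i ^ 4 * a ^ 2 + b ^ 2) ^ 2 := by
        have hle : S i ^ 2 * a ^ 2 + b ^ 2 / S i ^ 2 ≤ coneDenom ε (S i) a b := by
          unfold coneDenom; linarith
        calc coneWeight ε (S i) a b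
            ≤ a ^ 2 * b ^ 2 / (S i ^ 2 * a ^ 2 + b ^ 2 / S i ^ 2) ^ 2 := by
              unfold coneWeight; gcongr
          _ = _ := by field_simp
      refine e1.trans ?_
      simp only [hψ, hSsucc]
      have hp : 0 < S i ^ 4 * a ^ 2 := by positivity
      have hq : 0 < b ^ 2 := by positivity
      rw [show (2 * S i) ^ 4 * a ^ 2 = 16 * (S i ^ 4 * a ^ 2) by ring]
      generalize S i ^ 4 * a ^ 2 = p at *
      generalize b ^ 2 = q at *
      have : 2 * (16 * p / (16 * p + q) - p / (p + q)) =
          30 * p * q / ((16 * p + q) * (p + q)) := by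
        field_simp; ring
      rw [this, div_le_div_iff₀ (by positivity) (by positivity)]
      have : 0 ≤ p * q * (p + q) * (14 * p + 29 * q) := by positivity
      nlinarith
    calc ∑ i ∈ Finset.range N, coneWeight ε (S i) a b
        ≤ ∑ i ∈ Finset.range N, 2 * (ψ (i + 1) - ψ i) := Finset.sum_le_sum fun i _ => key i
      _ = 2 * (ψ N - ψ 0) := by rw [← Finset.mul_sum, Finset.sum_range_sub]
      _ ≤ 2 := by linarith [hψ0 0, hψ1 N]

/-- For `a b ≠ 0` the dyadic cone functions eventually dominate a fixed multiple of `|a b|`. -/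
lemma eventually_abs_mul_le_sum_coneFun_sq (a b : ℝ) :
    ∀ᶠ n : ℕ in atTop, |a * b| / 5184 ≤
      ∑ i ∈ Finset.range (2 * n),
        coneFun (1 / ((n : ℝ) + 1)) ((2 : ℝ) ^ ((i : ℤ) - n)) a b ^ 2 := by
  rcases eq_or_ne (a * b) 0 with h | h
  · refine Eventually.of_forall fun n => ?_
    rw [h, abs_zero, zero_div]
    exact Finset.sum_nonneg fun i _ => sq_nonneg _
  · have ha : 0 < |a| := abs_pos.2 (left_ne_zero_of_mul h)
    have hb : 0 < |b| := abs_pos.2 (right_ne_zero_of_mul h)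
    have hab : 0 < |a * b| := abs_pos.2 h
    obtain ⟨k, hk1, hk2⟩ := exists_mem_Ico_zpow (div_pos hb ha) (by norm_num : (1 : ℝ) < 4)
    have hsq : ((2 : ℝ) ^ k) ^ 2 = 4 ^ k := by
      rw [← zpow_natCast, zpow_comm, zpow_natCast]; norm_num
    rw [le_div_iff₀ ha, ← hsq] at hk1
    rw [zpow_add_one₀ (by norm_num), div_lt_iff₀ ha, ← hsq] at hk2
    have hlim : ∀ᶠ n : ℕ in atTop, 1 / ((n : ℝ) + 1) < |a * b| :=
      tendsto_one_div_add_atTop_nhds_zero_nat.eventually_lt_const hab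
    filter_upwards [hlim, eventually_gt_atTop k.natAbs] with n hn hkn
    have hmem : (k + n).toNat ∈ Finset.range (2 * n) := by
      rw [Finset.mem_range]; omega
    have hcast : (((k + n).toNat : ℕ) : ℤ) - n = k := by omega
    refine le_trans ?_ (Finset.single_le_sum (fun i _ => sq_nonneg _) hmem)
    rw [hcast]
    exact abs_mul_le_coneFun_sq (by positivity) hab hn.le (by positivity) hk1 (by linarith)

lemma norm_gradient {d : ℕ} (u : Euc d → ℝ) (x : Euc d) : ‖gradient u x‖ = ‖fderiv ℝ u x‖ := by
  simp [gradient]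

lemma contDiffOn_coneFun {d : ℕ} {t : Set (Euc d)} {u v : Euc d → ℝ} {ε s : ℝ} (hε : 0 < ε)
    (hu : ContDiffOn ℝ 1 u t) (hv : ContDiffOn ℝ 1 v t) :
    ContDiffOn ℝ 1 (fun x => coneFun ε s (u x) (v x)) t := by
  have hR : ContDiffOn ℝ 1 (fun x => coneDenom ε s (u x) (v x)) t :=
    ((contDiffOn_const.mul (hu.pow 2)).add ((hv.pow 2).div_const _)).add contDiffOn_const
  exact ((contDiffOn_const.mul (hu.pow 3)).mul (hv.pow 2)).div (hR.pow 2)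
    fun x _ => (pow_pos (coneDenom_pos hε _ _) 2).ne'

lemma continuousOn_coneWeight {d : ℕ} {t : Set (Euc d)} {u v : Euc d → ℝ} {ε s : ℝ}
    (hε : 0 < ε) (hu : ContinuousOn u t) (hv : ContinuousOn v t) :
    ContinuousOn (fun x => coneWeight ε s (u x) (v x)) t := by
  have hR : ContinuousOn (fun x => coneDenom ε s (u x) (v x)) t :=
    ((continuousOn_const.mul (hu.pow 2)).add ((hv.pow 2).div_const _)).add continuousOn_const
  exact ((hu.pow 2).mul (hv.pow 2)).div (hR.pow 2)
    fun x _ => (pow_pos (coneDenom_pos hε _ _) 2).ne'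

lemma norm_gradient_coneFun_sq_le {d : ℕ} {u v : Euc d → ℝ} {x : Euc d} {ε s : ℝ}
    (hε : 0 < ε) (hs : 0 < s) (hu : DifferentiableAt ℝ u x) (hv : DifferentiableAt ℝ v x) :
    ‖gradient (fun y => coneFun ε s (u y) (v y)) x‖ ^ 2 ≤
      s ^ 2 * (18 * (coneWeight ε s (u x) (v x) * ‖gradient u x‖ ^ 2)) +
        18 * (coneWeight ε s (u x) (v x) * ‖gradient v x‖ ^ 2) / s ^ 2 := by
  set a := u x with ha
  set b := v x with hb
  set R := coneDenom ε s a b with hRdef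
  have hR : 0 < R := coneDenom_pos hε a b
  set p := s * a ^ 2 * b ^ 2 / R ^ 2 * (3 - 4 * (s ^ 2 * a ^ 2 / R)) with hp
  set q := 2 * s * a ^ 3 * b / R ^ 2 * (1 - 2 * (b ^ 2 / s ^ 2 / R)) with hq
  have hd : HasFDerivAt (fun y => coneFun ε s (u y) (v y))
      (p • fderiv ℝ u x + q • fderiv ℝ v x) x := by
    have hu' := hu.hasFDerivAt
    have hv' := hv.hasFDerivAt
    have hR' : HasFDerivAt (fun y => coneDenom ε s (u y) (v y)) _ x :=
      (((hu'.pow 2).const_mul (s ^ 2)).fun_add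
        ((hv'.pow 2).mul_const ((s ^ 2)⁻¹))).add_const ε
    have hinv := (hasDerivAt_inv (pow_pos hR 2).ne').comp_hasFDerivAt x (hR'.pow 2)
    have hmain := (((hu'.pow 3).const_mul s).fun_mul (hv'.pow 2)).fun_mul hinv
    refine hmain.congr_fderiv ?_
    ext y
    simp only [Function.comp_apply, Nat.add_one_sub_one, pow_one, neg_smul, smul_neg,
      add_apply, neg_apply,
      smul_apply, smul_eq_mul, nsmul_eq_mul, Nat.cast_ofNat,
      ← ha, ← hb, ← hRdef, hp, hq]
    field_simp
    ring
  have hW0 := coneWeight_nonneg ε s a b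
  have hW1 : coneWeight ε s a b ≤ 1 := coneWeight_le_one hε hs a b
  have hA0 : 0 ≤ s ^ 2 * a ^ 2 / R := by positivity
  have hA1 : s ^ 2 * a ^ 2 / R ≤ 1 := div_le_one_of_le₀ (sq_mul_sq_le_coneDenom hε a b) hR.le
  have hB0 : 0 ≤ b ^ 2 / s ^ 2 / R := by positivity
  have hB1 : b ^ 2 / s ^ 2 / R ≤ 1 := div_le_one_of_le₀ (sq_div_sq_le_coneDenom hε a b) hR.le
  have hp2 : p ^ 2 ≤ 9 * s ^ 2 * coneWeight ε s a b := by
    have e : p ^ 2 = s ^ 2 * coneWeight ε s a b *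
        (coneWeight ε s a b * (3 - 4 * (s ^ 2 * a ^ 2 / R)) ^ 2) := by
      simp only [hp, coneWeight, ← hRdef]; ring
    have h9 : (3 - 4 * (s ^ 2 * a ^ 2 / R)) ^ 2 ≤ 9 := by nlinarith
    have : coneWeight ε s a b * (3 - 4 * (s ^ 2 * a ^ 2 / R)) ^ 2 ≤ 1 * 9 :=
      mul_le_mul hW1 h9 (sq_nonneg _) zero_le_one
    rw [e]
    nlinarith [mul_nonneg (sq_nonneg s) hW0]
  have hq2 : q ^ 2 ≤ 9 * coneWeight ε s a b / s ^ 2 := by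
    have e : q ^ 2 = coneWeight ε s a b / s ^ 2 *
        (4 * ((s ^ 2 * a ^ 2 / R) ^ 2 * (1 - 2 * (b ^ 2 / s ^ 2 / R)) ^ 2)) := by
      simp only [hq, coneWeight, ← hRdef]; field_simp; ring
    have h1 : (1 - 2 * (b ^ 2 / s ^ 2 / R)) ^ 2 ≤ 1 := by nlinarith
    have h2 : (s ^ 2 * a ^ 2 / R) ^ 2 * (1 - 2 * (b ^ 2 / s ^ 2 / R)) ^ 2 ≤ 1 :=
      mul_le_one₀ (pow_le_one₀ hA0 hA1) (sq_nonneg _) h1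
    have hWs : 0 ≤ coneWeight ε s a b / s ^ 2 := by positivity
    rw [e, mul_div_assoc 9, mul_comm (9 : ℝ)]
    exact mul_le_mul_of_nonneg_left (by linarith) hWs
  rw [norm_gradient, norm_gradient, norm_gradient, hd.fderiv]
  have hn : ‖p • fderiv ℝ u x + q • fderiv ℝ v x‖ ≤
      |p| * ‖fderiv ℝ u x‖ + |q| * ‖fderiv ℝ v x‖ := by
    simpa only [norm_smul, Real.norm_eq_abs] using
      norm_add_le (p • fderiv ℝ u x) (q • fderiv ℝ v x)
  calc ‖p • fderiv ℝ u x + q • fderiv ℝ v x‖ ^ 2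
      ≤ (|p| * ‖fderiv ℝ u x‖ + |q| * ‖fderiv ℝ v x‖) ^ 2 := by gcongr
    _ ≤ 2 * ((|p| * ‖fderiv ℝ u x‖) ^ 2 + (|q| * ‖fderiv ℝ v x‖) ^ 2) := add_sq_le
    _ = 2 * (p ^ 2 * ‖fderiv ℝ u x‖ ^ 2 + q ^ 2 * ‖fderiv ℝ v x‖ ^ 2) := by
        simp only [mul_pow, sq_abs]
    _ ≤ 2 * (9 * s ^ 2 * coneWeight ε s a b * ‖fderiv ℝ u x‖ ^ 2 +
          9 * coneWeight ε s a b / s ^ 2 * ‖fderiv ℝ v x‖ ^ 2) := by gcongr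
    _ = _ := by ring

lemma exists_norm_gradient_le {d : ℕ} {Ω : Set (Euc d)} (hΩ : IsOpen Ω) (hb : IsBounded Ω)
    {u : Euc d → ℝ} (hu : ContDiffOn ℝ 1 u (closure Ω)) :
    ∃ M : ℝ, ∀ x ∈ Ω, ‖gradient u x‖ ≤ M := by
  have hloc : ∀ x ∈ closure Ω, ∃ t ∈ 𝓝[closure Ω] x,
      ∃ M : ℝ, ∀ y ∈ t ∩ Ω, ‖gradient u y‖ ≤ M := by
    intro x hx
    obtain ⟨t, ht, -, f', hf', hc⟩ :=
      (contDiffWithinAt_succ_iff_hasFDerivWithinAt (n := 0) (by simp)).1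
        (by simpa using hu x hx)
    rw [Set.insert_eq_of_mem hx] at ht
    have hbd : ∀ᶠ y in 𝓝[t] x, ‖f' y‖ < ‖f' x‖ + 1 :=
      hc.continuousWithinAt.norm.eventually_lt_const (by linarith)
    obtain ⟨V, hVo, hxV, hV⟩ := mem_nhdsWithin.1 ht
    obtain ⟨V', hVo', hxV', hV'⟩ := mem_nhdsWithin.1 hbd
    refine ⟨V ∩ V' ∩ closure Ω, mem_nhdsWithin.2 ⟨V ∩ V', hVo.inter hVo', ⟨hxV, hxV'⟩, subset_rfl⟩,
      ‖f' x‖ + 1, ?_⟩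
    rintro y ⟨⟨⟨hyV, hyV'⟩, hyc⟩, hyΩ⟩
    have hyt : y ∈ t := hV ⟨hyV, hyc⟩
    have hnhds : t ∈ 𝓝 y := by
      filter_upwards [hVo.mem_nhds hyV, hΩ.mem_nhds hyΩ] with z hz hzΩ
      exact hV ⟨hz, subset_closure hzΩ⟩
    rw [norm_gradient, ((hf' y hyt).hasFDerivAt hnhds).fderiv]
    exact (hV' ⟨hyV', hyt⟩).le
  have hK : IsCompact (closure Ω) := hb.isCompact_closure
  have := hK.induction_on (p := fun t => ∃ M : ℝ, ∀ y ∈ t ∩ Ω, ‖gradient u y‖ ≤ M)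
    ⟨0, by simp⟩
    (fun s t hst ⟨M, hM⟩ => ⟨M, fun y hy => hM y ⟨hst hy.1, hy.2⟩⟩)
    (fun s t ⟨M, hM⟩ ⟨M', hM'⟩ => ⟨max M M', fun y hy => hy.1.elim
      (fun h => (hM y ⟨h, hy.2⟩).trans (le_max_left _ _))
      (fun h => (hM' y ⟨h, hy.2⟩).trans (le_max_right _ _))⟩)
    hloc
  obtain ⟨M, hM⟩ := this
  exact ⟨M, fun x hx => hM x ⟨subset_closure hx, hx⟩⟩

lemma continuousOn_gradient {d : ℕ} {Ω : Set (Euc d)} (hΩ : IsOpen Ω)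
    {u : Euc d → ℝ} (hu : ContDiffOn ℝ 1 u (closure Ω)) : ContinuousOn (gradient u) Ω :=
  (InnerProductSpace.toDual ℝ (Euc d)).symm.continuous.comp_continuousOn
    ((hu.mono subset_closure).continuousOn_fderiv_of_isOpen hΩ le_rfl)

lemma integrableOn_of_continuousOn_closure {d : ℕ} {Ω : Set (Euc d)} (hb : IsBounded Ω)
    {f : Euc d → ℝ} (hf : ContinuousOn f (closure Ω)) : IntegrableOn f Ω :=
  (hf.integrableOn_compact hb.isCompact_closure).mono_set subset_closure

lemma integrableOn_norm_gradient_sq {d : ℕ} {Ω : Set (Euc d)} (hΩ : IsOpen Ω)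
    (hb : IsBounded Ω) {u : Euc d → ℝ} (hu : ContDiffOn ℝ 1 u (closure Ω)) :
    IntegrableOn (fun x => ‖gradient u x‖ ^ 2) Ω := by
  obtain ⟨M, hM⟩ := exists_norm_gradient_le hΩ hb hu
  refine IntegrableOn.of_bound (C := M ^ 2) hb.measure_lt_top
    (((continuousOn_gradient hΩ hu).norm.pow 2).aestronglyMeasurable hΩ.measurableSet) ?_
  refine (ae_restrict_iff' hΩ.measurableSet).2 (Eventually.of_forall fun x hx => ?_)
  rw [Real.norm_of_nonneg (by positivity)]
  have := hM x hx
  gcongr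

/-- A weight with values in `[0, 1]` preserves integrability of nonnegative functions. -/
lemma integrableOn_coneWeight_mul {d : ℕ} {Ω : Set (Euc d)} (hΩ : IsOpen Ω)
    {u v : Euc d → ℝ} (hu : ContDiffOn ℝ 1 u (closure Ω)) (hv : ContDiffOn ℝ 1 v (closure Ω))
    {ε s : ℝ} (hε : 0 < ε) (hs : 0 < s) {g : Euc d → ℝ} (hg : IntegrableOn g Ω) :
    IntegrableOn (fun x => coneWeight ε s (u x) (v x) * g x) Ω := by
  refine Integrable.bdd_mul (c := 1) hg
    (((continuousOn_coneWeight hε hu.continuousOn hv.continuousOn).mono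
      subset_closure).aestronglyMeasurable hΩ.measurableSet) (Eventually.of_forall fun x => ?_)
  rw [Real.norm_of_nonneg (coneWeight_nonneg _ _ _ _)]
  exact coneWeight_le_one hε hs _ _

lemma le_two_mul_sqrt_mul_sqrt {x a b : ℝ} (ha : 0 ≤ a) (hb : 0 ≤ b)
    (h : ∀ c : ℝ, 0 < c → x ≤ c ^ 2 * a + b / c ^ 2) : x ≤ 2 * √a * √b := by
  have hη : ∀ η : ℝ, 0 < η → x ≤ 2 * √a * √b + η * (√a + √b) := by
    intro η hη
    have hA := Real.sqrt_nonneg a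
    have hB := Real.sqrt_nonneg b
    have hc : 0 < (√b + η) / (√a + η) := by positivity
    have := h (√((√b + η) / (√a + η))) (Real.sqrt_pos.2 hc)
    rw [Real.sq_sqrt hc.le] at this
    refine this.trans ?_
    have e1 : (√b + η) / (√a + η) * a ≤ (√b + η) * √a := by
      nth_rw 2 [← Real.mul_self_sqrt ha]
      rw [div_mul_eq_mul_div, div_le_iff₀ (by positivity)]
      have : 0 ≤ (√b + η) * √a * η := by positivity
      nlinarith
    have e2 : b / ((√b + η) / (√a + η)) ≤ (√a + η) * √b := by
      nth_rw 1 [← Real.mul_self_sqrt hb]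
      rw [div_div_eq_mul_div, div_le_iff₀ (by positivity)]
      have : 0 ≤ (√a + η) * √b * η := by positivity
      nlinarith
    linarith
  refine le_of_forall_pos_le_add fun η h0 => ?_
  have hpos : 0 < √a + √b + 1 := by positivity
  refine (hη (η / (√a + √b + 1)) (by positivity)).trans ?_
  gcongr
  rw [div_mul_eq_mul_div, div_le_iff₀ hpos]
  nlinarith

lemma add_weightedNormSq {d : ℕ} {Ω : Set (Euc d)} (hΩ : IsOpen Ω) (hb : IsBounded Ω)
    {u v : Euc d → ℝ} (hu : ContDiffOn ℝ 1 u (closure Ω)) (hv : ContDiffOn ℝ 1 v (closure Ω))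
    (δ : ℝ) :
    IntegrableOn (fun x => ‖gradient u x‖ ^ 2 + ‖gradient v x‖ ^ 2 +
      1 / δ ^ 2 * ((u x) ^ 2 + (v x) ^ 2)) Ω ∧
    ∫ x in Ω, (‖gradient u x‖ ^ 2 + ‖gradient v x‖ ^ 2 +
      1 / δ ^ 2 * ((u x) ^ 2 + (v x) ^ 2)) = weightedNormSq Ω δ u + weightedNormSq Ω δ v := by
  have iu := integrableOn_norm_gradient_sq hΩ hb hu
  have iv := integrableOn_norm_gradient_sq hΩ hb hv
  have ju : IntegrableOn (fun x => u x ^ 2) Ω :=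
    integrableOn_of_continuousOn_closure hb (hu.continuousOn.pow 2)
  have jv : IntegrableOn (fun x => v x ^ 2) Ω :=
    integrableOn_of_continuousOn_closure hb (hv.continuousOn.pow 2)
  refine ⟨(iu.add iv).add ((ju.add jv).const_mul _), ?_⟩
  have h1 : ∫ x in Ω, (‖gradient u x‖ ^ 2 + ‖gradient v x‖ ^ 2 +
      1 / δ ^ 2 * ((u x) ^ 2 + (v x) ^ 2)) =
      (∫ x in Ω, (‖gradient u x‖ ^ 2 + ‖gradient v x‖ ^ 2)) +
        ∫ x in Ω, 1 / δ ^ 2 * ((u x) ^ 2 + (v x) ^ 2) :=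
    integral_add (iu.add iv) ((ju.add jv).const_mul _)
  rw [h1, integral_add iu iv, integral_const_mul, integral_add ju jv]
  unfold weightedNormSq
  ring

lemma boundary_integral_coneFun_sq_le {d : ℕ} {Ω : Set (Euc d)} (hΩ : IsOpen Ω)
    (hb : IsBounded Ω) {σ : Measure (Euc d)} {CΓ : ℝ} (hCΓ : 0 < CΓ)
    (htrace : ∀ u : Euc d → ℝ, ContDiffOn ℝ 1 u (closure Ω) →
      (∫ x in frontier Ω, (u x) ^ 2 ∂σ) ≤
        CΓ * (Real.sqrt (∫ x in Ω, ‖gradient u x‖ ^ 2) *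
              Real.sqrt (∫ x in Ω, (u x) ^ 2) + ∫ x in Ω, (u x) ^ 2))
    {δ : ℝ} (hδ : 0 < δ) (hδ1 : δ ≤ 1) {u v : Euc d → ℝ}
    (hu : ContDiffOn ℝ 1 u (closure Ω)) (hv : ContDiffOn ℝ 1 v (closure Ω))
    {ε s : ℝ} (hε : 0 < ε) (hs : 0 < s) :
    (∫ x in frontier Ω, coneFun ε s (u x) (v x) ^ 2 ∂σ) ≤
      36 * CΓ * δ * ∫ x in Ω, coneWeight ε s (u x) (v x) *
        (‖gradient u x‖ ^ 2 + ‖gradient v x‖ ^ 2 + 1 / δ ^ 2 * ((u x) ^ 2 + (v x) ^ 2)) := by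
  have hf := contDiffOn_coneFun (s := s) hε hu hv
  have hdu : ∀ x ∈ Ω, DifferentiableAt ℝ u x := fun x hx =>
    ((hu.mono subset_closure).differentiableOn one_ne_zero).differentiableAt (hΩ.mem_nhds hx)
  have hdv : ∀ x ∈ Ω, DifferentiableAt ℝ v x := fun x hx =>
    ((hv.mono subset_closure).differentiableOn one_ne_zero).differentiableAt (hΩ.mem_nhds hx)
  have iu := integrableOn_coneWeight_mul hΩ hu hv hε hs (integrableOn_norm_gradient_sq hΩ hb hu)
  have iv := integrableOn_coneWeight_mul hΩ hu hv hε hs (integrableOn_norm_gradient_sq hΩ hb hv)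
  have ju := integrableOn_coneWeight_mul hΩ hu hv hε hs
    (integrableOn_of_continuousOn_closure hb (hu.continuousOn.pow 2))
  have jv := integrableOn_coneWeight_mul hΩ hu hv hε hs
    (integrableOn_of_continuousOn_closure hb (hv.continuousOn.pow 2))
  have hF := integrableOn_of_continuousOn_closure hb (hf.continuousOn.pow 2)
  have hP := integrableOn_norm_gradient_sq hΩ hb hf
  simp only [Pi.pow_apply] at ju jv
  have hsplit : ∫ x in Ω, coneWeight ε s (u x) (v x) *
        (‖gradient u x‖ ^ 2 + ‖gradient v x‖ ^ 2 + 1 / δ ^ 2 * ((u x) ^ 2 + (v x) ^ 2)) =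
      (∫ x in Ω, coneWeight ε s (u x) (v x) * ‖gradient u x‖ ^ 2) +
      (∫ x in Ω, coneWeight ε s (u x) (v x) * ‖gradient v x‖ ^ 2) +
      ((∫ x in Ω, coneWeight ε s (u x) (v x) * u x ^ 2) +
        (∫ x in Ω, coneWeight ε s (u x) (v x) * v x ^ 2)) / δ ^ 2 := by
    rw [← integral_add iu iv, ← integral_add ju jv, ← integral_div]
    refine Eq.trans ?_ (integral_add (iu.add iv) ((ju.add jv).div_const (δ ^ 2)))
    congr 1; ext x; ring
  have hPle : (∫ x in Ω, ‖gradient (fun y => coneFun ε s (u y) (v y)) x‖ ^ 2) ≤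
      s ^ 2 * (18 * ∫ x in Ω, coneWeight ε s (u x) (v x) * ‖gradient u x‖ ^ 2) +
        18 * (∫ x in Ω, coneWeight ε s (u x) (v x) * ‖gradient v x‖ ^ 2) / s ^ 2 := by
    rw [← integral_const_mul, ← integral_const_mul, ← integral_const_mul, ← integral_div,
      ← integral_add ((iu.const_mul _).const_mul _) ((iv.const_mul _).div_const _)]
    exact setIntegral_mono_on hP
      (((iu.const_mul _).const_mul _).add ((iv.const_mul _).div_const _)) hΩ.measurableSet
      fun x hx => norm_gradient_coneFun_sq_le hε hs (hdu x hx) (hdv x hx)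
  have hFu : (∫ x in Ω, coneFun ε s (u x) (v x) ^ 2) ≤
      s ^ 2 * ∫ x in Ω, coneWeight ε s (u x) (v x) * u x ^ 2 := by
    rw [← integral_const_mul]
    exact integral_mono hF (ju.const_mul _) fun x => coneFun_sq_le_mul_sq hε hs _ _
  have hFv : (∫ x in Ω, coneFun ε s (u x) (v x) ^ 2) ≤
      (∫ x in Ω, coneWeight ε s (u x) (v x) * v x ^ 2) / s ^ 2 := by
    rw [← integral_div]
    exact integral_mono hF (jv.div_const _) fun x => coneFun_sq_le_div_sq hε hs _ _
  have hW := fun x => coneWeight_nonneg ε s (u x) (v x)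
  have a0 : 0 ≤ ∫ x in Ω, coneWeight ε s (u x) (v x) * ‖gradient u x‖ ^ 2 :=
    integral_nonneg fun x => mul_nonneg (hW x) (sq_nonneg _)
  have b0 : 0 ≤ ∫ x in Ω, coneWeight ε s (u x) (v x) * ‖gradient v x‖ ^ 2 :=
    integral_nonneg fun x => mul_nonneg (hW x) (sq_nonneg _)
  have e0 : 0 ≤ ∫ x in Ω, coneWeight ε s (u x) (v x) * u x ^ 2 :=
    integral_nonneg fun x => mul_nonneg (hW x) (sq_nonneg _)
  have g0 : 0 ≤ ∫ x in Ω, coneWeight ε s (u x) (v x) * v x ^ 2 :=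
    integral_nonneg fun x => mul_nonneg (hW x) (sq_nonneg _)
  have F0 : 0 ≤ ∫ x in Ω, coneFun ε s (u x) (v x) ^ 2 := integral_nonneg fun x => sq_nonneg _
  have P0 : 0 ≤ ∫ x in Ω, ‖gradient (fun y => coneFun ε s (u y) (v y)) x‖ ^ 2 :=
    integral_nonneg fun x => sq_nonneg _
  refine (htrace _ hf).trans ?_
  rw [hsplit]
  generalize (∫ x in Ω, coneWeight ε s (u x) (v x) * ‖gradient u x‖ ^ 2) = a at *
  generalize (∫ x in Ω, coneWeight ε s (u x) (v x) * ‖gradient v x‖ ^ 2) = b at *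
  generalize (∫ x in Ω, coneWeight ε s (u x) (v x) * u x ^ 2) = e at *
  generalize (∫ x in Ω, coneWeight ε s (u x) (v x) * v x ^ 2) = g at *
  generalize (∫ x in Ω, coneFun ε s (u x) (v x) ^ 2) = F at *
  generalize (∫ x in Ω, ‖gradient (fun y => coneFun ε s (u y) (v y)) x‖ ^ 2) = P at *
  obtain ⟨y, rfl⟩ : ∃ y, e = δ ^ 2 * y := ⟨e / δ ^ 2, by field_simp⟩
  obtain ⟨z, rfl⟩ : ∃ z, g = δ ^ 2 * z := ⟨g / δ ^ 2, by field_simp⟩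
  have hy : 0 ≤ y := nonneg_of_mul_nonneg_right e0 (by positivity)
  have hz : 0 ≤ z := nonneg_of_mul_nonneg_right g0 (by positivity)
  have hdiv : (δ ^ 2 * y + δ ^ 2 * z) / δ ^ 2 = y + z := by field_simp
  rw [hdiv]
  have hsqrt : √P * √F ≤ δ * (18 * (a + b + (y + z))) := by
    rw [← Real.sqrt_mul P0]
    refine Real.sqrt_le_iff.2 ⟨by positivity, ?_⟩
    calc P * F ≤ (s ^ 2 * (18 * a) + 18 * b / s ^ 2) * F := by gcongr
      _ = s ^ 2 * (18 * a) * F + 18 * b / s ^ 2 * F := by ring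
      _ ≤ s ^ 2 * (18 * a) * (δ ^ 2 * z / s ^ 2) + 18 * b / s ^ 2 * (s ^ 2 * (δ ^ 2 * y)) := by
          gcongr
      _ = δ ^ 2 * (18 * (a * z + b * y)) := by field_simp
      _ ≤ δ ^ 2 * (18 * (a + b + (y + z))) ^ 2 := by
          gcongr
          nlinarith [mul_nonneg a0 hz, mul_nonneg b0 hy, mul_nonneg a0 b0, mul_nonneg a0 hy,
            mul_nonneg b0 hz, mul_nonneg hy hz, sq_nonneg a, sq_nonneg b, sq_nonneg y,
            sq_nonneg z]
      _ = _ := by ring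
  have hFle : F ≤ δ ^ 2 * (y + z) := by
    refine abs_le_of_sq_le_sq' ?_ (by positivity) |>.2
    calc F ^ 2 = F * F := sq F
      _ ≤ s ^ 2 * (δ ^ 2 * y) * (δ ^ 2 * z / s ^ 2) := mul_le_mul hFu hFv F0 (by positivity)
      _ = (δ ^ 2) ^ 2 * (y * z) := by field_simp
      _ ≤ (δ ^ 2) ^ 2 * (y + z) ^ 2 := by gcongr; nlinarith [mul_nonneg hy hz]
      _ = _ := by ring
  have hFle' : F ≤ δ * (18 * (a + b + (y + z))) := by
    refine hFle.trans ?_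
    rw [sq, mul_assoc]
    refine mul_le_mul_of_nonneg_left ?_ hδ.le
    calc δ * (y + z) ≤ 1 * (y + z) := by gcongr
      _ ≤ _ := by linarith
  calc CΓ * (√P * √F + F)
      ≤ CΓ * (δ * (18 * (a + b + (y + z))) + δ * (18 * (a + b + (y + z)))) := by gcongr
    _ = _ := by ring

lemma abs_boundary_integral_mul_le {d : ℕ} {Ω : Set (Euc d)} (hΩ : IsOpen Ω)
    (hb : IsBounded Ω) {σ : Measure (Euc d)} {CΓ : ℝ} (hCΓ : 0 < CΓ)
    (htrace : ∀ u : Euc d → ℝ, ContDiffOn ℝ 1 u (closure Ω) →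
      (∫ x in frontier Ω, (u x) ^ 2 ∂σ) ≤
        CΓ * (Real.sqrt (∫ x in Ω, ‖gradient u x‖ ^ 2) *
              Real.sqrt (∫ x in Ω, (u x) ^ 2) + ∫ x in Ω, (u x) ^ 2))
    {δ : ℝ} (hδ : 0 < δ) (hδ1 : δ ≤ 1) {u v : Euc d → ℝ}
    (hu : ContDiffOn ℝ 1 u (closure Ω)) (hv : ContDiffOn ℝ 1 v (closure Ω)) :
    |∫ x in frontier Ω, u x * v x ∂σ| ≤
      373248 * CΓ * δ * (weightedNormSq Ω δ u + weightedNormSq Ω δ v) := by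
  obtain ⟨hG, hGeq⟩ := add_weightedNormSq hΩ hb hu hv δ
  set G : Euc d → ℝ := fun x => ‖gradient u x‖ ^ 2 + ‖gradient v x‖ ^ 2 +
      1 / δ ^ 2 * ((u x) ^ 2 + (v x) ^ 2) with hGdef
  have hG0 : ∀ x, 0 ≤ G x := fun x => by positivity
  rw [← hGeq]
  have hGint : 0 ≤ ∫ x in Ω, G x := integral_nonneg hG0
  by_cases hint : IntegrableOn (fun x => u x * v x) (frontier Ω) σ
  swap
  · rw [integral_undef hint, abs_zero]; positivity
  have hfr : MeasurableSet (frontier Ω) := isClosed_frontier.measurableSet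
  have hab : IntegrableOn (fun x => |u x * v x|) (frontier Ω) σ := hint.abs
  set ε : ℕ → ℝ := fun n => 1 / ((n : ℝ) + 1) with hεdef
  have hε : ∀ n, 0 < ε n := fun n => by positivity
  set S : ℕ → ℕ → ℝ := fun n i => (2 : ℝ) ^ ((i : ℤ) - n) with hSdef
  have hS : ∀ n i, 0 < S n i := fun n i => by positivity
  have hfm : ∀ n i, AEStronglyMeasurable
      (fun x => coneFun (ε n) (S n i) (u x) (v x) ^ 2) (σ.restrict (frontier Ω)) := fun n i =>
    (((contDiffOn_coneFun (hε n) hu hv).continuousOn.pow 2).mono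
      frontier_subset_closure).aestronglyMeasurable hfr
  have hfi : ∀ n i, IntegrableOn
      (fun x => coneFun (ε n) (S n i) (u x) (v x) ^ 2) (frontier Ω) σ := fun n i =>
    Integrable.mono' hab (hfm n i) (Eventually.of_forall fun x => by
      rw [Real.norm_of_nonneg (sq_nonneg _)]
      exact coneFun_sq_le_abs_mul (hε n) (hS n i) _ _)
  set h : ℕ → Euc d → ℝ := fun n x =>
    ∑ i ∈ Finset.range (2 * n), coneFun (ε n) (S n i) (u x) (v x) ^ 2 with hhdef
  have hhi : ∀ n, IntegrableOn (h n) (frontier Ω) σ := fun n =>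
    integrable_finsetSum _ fun i _ => hfi n i
  have hh0 : ∀ n x, 0 ≤ h n x := fun n x => Finset.sum_nonneg fun i _ => sq_nonneg _
  have hci : IntegrableOn (fun x => |u x * v x| / 5184) (frontier Ω) σ := hab.div_const _
  have hbound : ∀ n, (∫ x in frontier Ω, h n x ∂σ) ≤ 72 * CΓ * δ * ∫ x in Ω, G x := by
    intro n
    have hWi : ∀ i, IntegrableOn (fun x => coneWeight (ε n) (S n i) (u x) (v x) * G x) Ω :=
      fun i => integrableOn_coneWeight_mul hΩ hu hv (hε n) (hS n i) hG
    calc (∫ x in frontier Ω, h n x ∂σ)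
        = ∑ i ∈ Finset.range (2 * n),
            ∫ x in frontier Ω, coneFun (ε n) (S n i) (u x) (v x) ^ 2 ∂σ :=
          integral_finsetSum _ fun i _ => hfi n i
      _ ≤ ∑ i ∈ Finset.range (2 * n), 36 * CΓ * δ *
            ∫ x in Ω, coneWeight (ε n) (S n i) (u x) (v x) * G x :=
          Finset.sum_le_sum fun i _ =>
            boundary_integral_coneFun_sq_le hΩ hb hCΓ htrace hδ hδ1 hu hv (hε n) (hS n i)
      _ = 36 * CΓ * δ * ∫ x in Ω, ∑ i ∈ Finset.range (2 * n),
            coneWeight (ε n) (S n i) (u x) (v x) * G x := by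
          rw [← Finset.mul_sum, integral_finsetSum _ fun i _ => hWi i]
      _ ≤ 36 * CΓ * δ * ∫ x in Ω, 2 * G x := by
          refine mul_le_mul_of_nonneg_left ?_ (by positivity)
          refine integral_mono (integrable_finsetSum _ fun i _ => hWi i) (hG.const_mul 2)
            fun x => ?_
          simp only
          rw [← Finset.sum_mul]
          exact mul_le_mul_of_nonneg_right (sum_coneWeight_le (hε n) n (2 * n) _ _) (hG0 x)
      _ = _ := by rw [integral_const_mul]; ring
  have hlim : Tendsto (fun n => ∫ x in frontier Ω, min (h n x) (|u x * v x| / 5184) ∂σ) atTop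
      (𝓝 (∫ x in frontier Ω, |u x * v x| / 5184 ∂σ)) := by
    refine tendsto_integral_of_dominated_convergence _
      (fun n => (hhi n).aestronglyMeasurable.inf hci.aestronglyMeasurable) hci
      (fun n => Eventually.of_forall fun x => ?_) (Eventually.of_forall fun x => ?_)
    · rw [Real.norm_of_nonneg (le_min (hh0 n x) (by positivity))]
      exact min_le_right _ _
    · refine tendsto_const_nhds.congr' ?_
      filter_upwards [eventually_abs_mul_le_sum_coneFun_sq (u x) (v x)] with n hn
      exact (min_eq_right hn).symm
  have hle : (∫ x in frontier Ω, |u x * v x| / 5184 ∂σ) ≤ 72 * CΓ * δ * ∫ x in Ω, G x :=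
    le_of_tendsto' hlim fun n => (integral_mono ((hhi n).inf hci) (hhi n)
      fun x => min_le_left _ _).trans (hbound n)
  rw [integral_div] at hle
  have := abs_integral_le_integral_abs (f := fun x => u x * v x) (μ := σ.restrict (frontier Ω))
  linarith

lemma gradient_const_mul {d : ℕ} (c : ℝ) (u : Euc d → ℝ) (x : Euc d) :
    gradient (fun y => c * u y) x = c • gradient u x := by
  unfold gradient
  rw [← map_smul]
  congr 1
  exact congrFun (fderiv_const_smul_field (𝕜 := ℝ) (f := u) c) x

lemma weightedNormSq_const_mul {d : ℕ} (Ω : Set (Euc d)) (δ c : ℝ) (u : Euc d → ℝ) :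
    weightedNormSq Ω δ (fun x => c * u x) = c ^ 2 * weightedNormSq Ω δ u := by
  simp only [weightedNormSq, gradient_const_mul, norm_smul, mul_pow, integral_const_mul,
    Real.norm_eq_abs, sq_abs]
  ring

lemma weightedNormSq_nonneg {d : ℕ} (Ω : Set (Euc d)) (δ : ℝ) (u : Euc d → ℝ) :
    0 ≤ weightedNormSq Ω δ u :=
  add_nonneg (integral_nonneg fun x => sq_nonneg _)
    (mul_nonneg (by positivity) (integral_nonneg fun x => sq_nonneg _))

/-- The bilinear form `a^δ(u, v)`. -/
def robinForm {d : ℕ} (Ω : Set (Euc d)) (σ : Measure (Euc d)) (α δ : ℝ) (u v : Euc d → ℝ) : ℝ :=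
  (∫ x in Ω, ⟪gradient u x, gradient v x⟫) -
    (1 / δ) * (∫ x in frontier Ω, u x * v x ∂σ) + (α / δ ^ 2) * ∫ x in Ω, u x * v x

lemma robinForm_const_mul {d : ℕ} (Ω : Set (Euc d)) (σ : Measure (Euc d)) (α δ : ℝ)
    (u v : Euc d → ℝ) {c : ℝ} (hc : c ≠ 0) :
    robinForm Ω σ α δ (fun x => c * u x) (fun x => c⁻¹ * v x) = robinForm Ω σ α δ u v := by
  have h1 : ∀ x, c * u x * (c⁻¹ * v x) = u x * v x := fun x => by field_simp
  have h2 : ∀ x, ⟪c • gradient u x, c⁻¹ • gradient v x⟫ = ⟪gradient u x, gradient v x⟫ :=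
    fun x => by rw [real_inner_smul_left, real_inner_smul_right, mul_inv_cancel_left₀ hc]
  simp only [robinForm, gradient_const_mul, h1, h2]

lemma abs_robinForm_le_add {d : ℕ} {Ω : Set (Euc d)} (hΩ : IsOpen Ω)
    (hb : IsBounded Ω) {σ : Measure (Euc d)} {CΓ : ℝ} (hCΓ : 0 < CΓ)
    (htrace : ∀ u : Euc d → ℝ, ContDiffOn ℝ 1 u (closure Ω) →
      (∫ x in frontier Ω, (u x) ^ 2 ∂σ) ≤
        CΓ * (Real.sqrt (∫ x in Ω, ‖gradient u x‖ ^ 2) *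
              Real.sqrt (∫ x in Ω, (u x) ^ 2) + ∫ x in Ω, (u x) ^ 2))
    {α : ℝ} (hα : 0 < α) {δ : ℝ} (hδ : 0 < δ) (hδ1 : δ ≤ 1) {u v : Euc d → ℝ}
    (hu : ContDiffOn ℝ 1 u (closure Ω)) (hv : ContDiffOn ℝ 1 v (closure Ω)) :
    |robinForm Ω σ α δ u v| ≤
      (1 + 373248 * CΓ + α) * (weightedNormSq Ω δ u + weightedNormSq Ω δ v) := by
  have iu := integrableOn_norm_gradient_sq hΩ hb hu
  have iv := integrableOn_norm_gradient_sq hΩ hb hv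
  have ju : IntegrableOn (fun x => u x ^ 2) Ω :=
    integrableOn_of_continuousOn_closure hb (hu.continuousOn.pow 2)
  have jv : IntegrableOn (fun x => v x ^ 2) Ω :=
    integrableOn_of_continuousOn_closure hb (hv.continuousOn.pow 2)
  have h1 : |∫ x in Ω, ⟪gradient u x, gradient v x⟫| ≤
      (∫ x in Ω, ‖gradient u x‖ ^ 2) + ∫ x in Ω, ‖gradient v x‖ ^ 2 := by
    rw [← integral_add iu iv, ← Real.norm_eq_abs]
    refine norm_integral_le_of_norm_le (iu.add iv) (Eventually.of_forall fun x => ?_)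
    have h := norm_inner_le_norm (𝕜 := ℝ) (gradient u x) (gradient v x)
    nlinarith [two_mul_le_add_sq ‖gradient u x‖ ‖gradient v x‖,
      norm_nonneg (gradient u x), norm_nonneg (gradient v x)]
  have h2 : |∫ x in Ω, u x * v x| ≤ (∫ x in Ω, u x ^ 2) + ∫ x in Ω, v x ^ 2 := by
    rw [← integral_add ju jv, ← Real.norm_eq_abs]
    refine norm_integral_le_of_norm_le (ju.add jv) (Eventually.of_forall fun x => ?_)
    rw [Real.norm_eq_abs, abs_le]
    constructor <;> nlinarith [sq_nonneg (u x + v x), sq_nonneg (u x - v x)]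
  have h3 := abs_boundary_integral_mul_le hΩ hb hCΓ htrace hδ hδ1 hu hv
  have h3' : |1 / δ * ∫ x in frontier Ω, u x * v x ∂σ| ≤
      373248 * CΓ * (weightedNormSq Ω δ u + weightedNormSq Ω δ v) := by
    rw [abs_mul, abs_of_pos (by positivity : 0 < 1 / δ)]
    calc 1 / δ * |∫ x in frontier Ω, u x * v x ∂σ|
        ≤ 1 / δ * (373248 * CΓ * δ * (weightedNormSq Ω δ u + weightedNormSq Ω δ v)) := by gcongr
      _ = _ := by field_simp
  have gu : 0 ≤ ∫ x in Ω, ‖gradient u x‖ ^ 2 := integral_nonneg fun x => sq_nonneg _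
  have gv : 0 ≤ ∫ x in Ω, ‖gradient v x‖ ^ 2 := integral_nonneg fun x => sq_nonneg _
  have mu : 0 ≤ 1 / δ ^ 2 * ∫ x in Ω, u x ^ 2 :=
    mul_nonneg (by positivity) (integral_nonneg fun x => sq_nonneg _)
  have mv : 0 ≤ 1 / δ ^ 2 * ∫ x in Ω, v x ^ 2 :=
    mul_nonneg (by positivity) (integral_nonneg fun x => sq_nonneg _)
  have h1' : |∫ x in Ω, ⟪gradient u x, gradient v x⟫| ≤
      weightedNormSq Ω δ u + weightedNormSq Ω δ v := by
    unfold weightedNormSq; linarith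
  have h2' : |α / δ ^ 2 * ∫ x in Ω, u x * v x| ≤
      α * (weightedNormSq Ω δ u + weightedNormSq Ω δ v) := by
    rw [abs_mul, abs_of_pos (by positivity : 0 < α / δ ^ 2)]
    calc α / δ ^ 2 * |∫ x in Ω, u x * v x|
        ≤ α / δ ^ 2 * ((∫ x in Ω, u x ^ 2) + ∫ x in Ω, v x ^ 2) := by gcongr
      _ = α * (1 / δ ^ 2 * (∫ x in Ω, u x ^ 2) + 1 / δ ^ 2 * ∫ x in Ω, v x ^ 2) := by ring
      _ ≤ _ := by
          unfold weightedNormSq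
          gcongr <;> linarith
  calc |robinForm Ω σ α δ u v|
      ≤ |∫ x in Ω, ⟪gradient u x, gradient v x⟫| +
          |1 / δ * ∫ x in frontier Ω, u x * v x ∂σ| + |α / δ ^ 2 * ∫ x in Ω, u x * v x| :=
        (abs_add_le _ _).trans (add_le_add_left (abs_sub _ _) _)
    _ ≤ _ := by linarith

/-- for `α > 0` the bilinear form
`a^δ(u,v) = ∫_Ω ∇u·∇v − (1/δ)∫_Γ uv dσ + (α/δ²)∫_Ω uv` is bounded uniformly
in `0 < δ ≤ 1` with respect to the weighted norm `‖·‖_{H¹_δ(Ω)}`. -/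
theorem robin_form_uniformly_bounded
    {d : ℕ} (hd : 2 ≤ d) (Ω : Set (Euc d))
    (hΩopen : IsOpen Ω) (hΩbdd : IsBounded Ω) (hΩconn : IsConnected Ω)
    (σ : Measure (Euc d))
    (CΓ : ℝ) (hCΓ : 0 < CΓ)
    (htrace : ∀ u : Euc d → ℝ, ContDiffOn ℝ 1 u (closure Ω) →
      (∫ x in frontier Ω, (u x) ^ 2 ∂σ) ≤
        CΓ * (Real.sqrt (∫ x in Ω, ‖gradient u x‖ ^ 2) *
              Real.sqrt (∫ x in Ω, (u x) ^ 2) + ∫ x in Ω, (u x) ^ 2))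
    (α : ℝ) (hα : 0 < α) :
    ∃ C : ℝ, 0 < C ∧ ∀ δ : ℝ, 0 < δ → δ ≤ 1 →
      ∀ u v : Euc d → ℝ, ContDiffOn ℝ 1 u (closure Ω) →
        ContDiffOn ℝ 1 v (closure Ω) →
        |(∫ x in Ω, ⟪gradient u x, gradient v x⟫) -
            (1 / δ) * (∫ x in frontier Ω, u x * v x ∂σ) +
            (α / δ ^ 2) * ∫ x in Ω, u x * v x| ≤
          C * Real.sqrt ((∫ x in Ω, ‖gradient u x‖ ^ 2) +
                (1 / δ ^ 2) * ∫ x in Ω, (u x) ^ 2) *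
            Real.sqrt ((∫ x in Ω, ‖gradient v x‖ ^ 2) +
                (1 / δ ^ 2) * ∫ x in Ω, (v x) ^ 2) := by
  refine ⟨2 * (1 + 373248 * CΓ + α), by positivity, fun δ hδ hδ1 u v hu hv => ?_⟩
  set K := 1 + 373248 * CΓ + α with hK
  have hK0 : 0 < K := by positivity
  have hle : |robinForm Ω σ α δ u v| / K ≤
      2 * √(weightedNormSq Ω δ u) * √(weightedNormSq Ω δ v) := by
    refine le_two_mul_sqrt_mul_sqrt (weightedNormSq_nonneg Ω δ u) (weightedNormSq_nonneg Ω δ v)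
      fun c hc => ?_
    have h := abs_robinForm_le_add hΩopen hΩbdd hCΓ htrace hα hδ hδ1
      (contDiffOn_const (c := c).mul hu) (contDiffOn_const (c := c⁻¹).mul hv)
    rw [robinForm_const_mul Ω σ α δ u v hc.ne', weightedNormSq_const_mul,
      weightedNormSq_const_mul] at h
    rw [div_le_iff₀ hK0, mul_comm _ K, div_eq_inv_mul, ← inv_pow]
    exact h
  rw [div_le_iff₀ hK0] at hle
  calc |robinForm Ω σ α δ u v|
      ≤ 2 * √(weightedNormSq Ω δ u) * √(weightedNormSq Ω δ v) * K := hle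
    _ = 2 * K * √(weightedNormSq Ω δ u) * √(weightedNormSq Ω δ v) := by ring
end
end

section
/- Let H be an infinite-dimensional separable real Hilbert space, let A : H → H be a bounded self-adjoint linear operator which is coercive (there is θ > 0 with ⟨A u, u⟩ ≥ θ ‖u‖² for all u ∈ H), and let B : H → H be a compact self-adjoint linear operator which is positive (⟨B u, u⟩ > 0 for all u ≠ 0). Then there exist a sequence (μ_k)_{k ∈ ℕ} of positive real numbers with μ_k → +∞ and nonzero vectors (u_k)_{k ∈ ℕ} in H such that A u_k = μ_k B u_k for every k, i.e. ⟨A u_k, v⟩ = μ_k ⟨B u_k, v⟩ for all v ∈ H. -/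
open MeasureTheory Filter Topology
open scoped RealInnerProductSpace

noncomputable section

open Module.End in
theorem ContinuousLinearMap.mul_norm_sq_le_inner_of_le_eigenvalues
    {E : Type*} [NormedAddCommGroup E] [InnerProductSpace ℝ E] [CompleteSpace E]
    {T : E →L[ℝ] E} (hT : IsCompactOperator T) (hTs : (T : E →ₗ[ℝ] E).IsSymmetric)
    {ε : ℝ} (h : ∀ l, HasEigenvalue (T : Module.End ℝ E) l → ε ≤ l) (x : E) :
    ε * ‖x‖ ^ 2 ≤ ⟪T x, x⟫ := by
  set W : Submodule ℝ E := ⨆ l, eigenspace (T : Module.End ℝ E) l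
  have hdense : Dense (W : Set E) := by
    rw [Submodule.dense_iff_topologicalClosure_eq_top,
      Submodule.topologicalClosure_eq_top_iff]
    exact orthogonalComplement_iSup_eigenspaces_eq_bot hT hTs
  have hclosed : IsClosed {y : E | ε * ‖y‖ ^ 2 ≤ ⟪T y, y⟫} :=
    isClosed_le (by fun_prop) (by fun_prop)
  refine hclosed.closure_subset_iff.2 ?_ (hdense x)
  intro y hy
  obtain ⟨f, rfl⟩ := (Submodule.mem_iSup_iff_exists_dfinsupp _ y).1 hy
  classical
  have hO := hTs.orthogonalFamily_eigenspaces
  set s := f.support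
  have hsum : DFinsupp.lsum ℕ (fun l => (eigenspace (T : Module.End ℝ E) l).subtype) f
      = ∑ l ∈ s, (eigenspace (T : Module.End ℝ E) l).subtypeₗᵢ (f l) := by
    simp [DFinsupp.lsum_apply_apply, DFinsupp.sumAddHom_apply, DFinsupp.sum, s]
  have hTsum : T (∑ l ∈ s, (eigenspace (T : Module.End ℝ E) l).subtypeₗᵢ (f l))
      = ∑ l ∈ s, (eigenspace (T : Module.End ℝ E) l).subtypeₗᵢ (l • f l) := by
    rw [map_sum]
    exact Finset.sum_congr rfl fun l _ => mem_eigenspace_iff.1 (f l).2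
  rw [Set.mem_ofPred_eq, hsum, hTsum, ← real_inner_self_eq_norm_sq,
    hO.inner_sum, hO.inner_sum, Finset.mul_sum]
  refine Finset.sum_le_sum fun l hl => ?_
  have hl' : HasEigenvalue (T : Module.End ℝ E) l :=
    hasEigenvalue_of_hasEigenvector (x := (f l : E))
      ⟨(f l).2, by simpa [s] using hl⟩
  rw [real_inner_smul_left]
  exact mul_le_mul_of_nonneg_right (h l hl') real_inner_self_nonneg

theorem FiniteDimensional.of_isCompactOperator_of_mul_norm_sq_le_inner
    {E : Type*} [NormedAddCommGroup E] [InnerProductSpace ℝ E] [CompleteSpace E]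
    {T : E →L[ℝ] E} (hT : IsCompactOperator T)
    {ε : ℝ} (hε : 0 < ε) (h : ∀ x, ε * ‖x‖ ^ 2 ≤ ⟪T x, x⟫) : FiniteDimensional ℝ E := by
  have hcoer : IsCoercive ((innerSL ℝ).comp T) :=
    ⟨ε, hε, fun u => by simpa [mul_assoc, pow_two] using h u⟩
  set e := hcoer.continuousLinearEquivOfBilin
  have he : ∀ v, e v = T v := fun v =>
    ext_inner_right ℝ fun w => by simp [e]
  refine FiniteDimensional.of_isCompactOperator_id (𝕜 := ℝ) ?_
  convert! hT.clm_comp (e.symm : E →L[ℝ] E) using 1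
  ext v
  simp [← he]

open Module.End in
theorem ContinuousLinearMap.exists_hasEigenvalue_mem_Ioo
    {E : Type*} [NormedAddCommGroup E] [InnerProductSpace ℝ E] [CompleteSpace E]
    (hinf : ¬ FiniteDimensional ℝ E)
    {T : E →L[ℝ] E} (hT : IsCompactOperator T) (hTs : (T : E →ₗ[ℝ] E).IsSymmetric)
    (hpos : ∀ x, x ≠ 0 → 0 < ⟪T x, x⟫) {ε : ℝ} (hε : 0 < ε) :
    ∃ l ∈ Set.Ioo 0 ε, HasEigenvalue (T : Module.End ℝ E) l := by
  by_contra! hno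
  refine hinf (.of_isCompactOperator_of_mul_norm_sq_le_inner hT hε
    (mul_norm_sq_le_inner_of_le_eigenvalues hT hTs fun l hl => ?_))
  by_contra! hlt
  refine hno l ⟨?_, hlt⟩ hl
  obtain ⟨x, hx, hx0⟩ := hl.exists_hasEigenvector
  have hTx : T x = l • x := mem_eigenspace_iff.1 hx
  have := hpos x hx0
  rw [hTx, real_inner_smul_left] at this
  exact pos_of_mul_pos_left this real_inner_self_nonneg

/-- A coercive symmetric bounded form is the inner product of an equivalent inner product space. -/
theorem ContinuousLinearMap.exists_equiv_inner_eq.{u}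
    {H : Type u} [NormedAddCommGroup H] [InnerProductSpace ℝ H]
    (A : H →L[ℝ] H) (hAsa : ∀ u v : H, ⟪A u, v⟫ = ⟪u, A v⟫)
    {θ : ℝ} (hθ : 0 < θ) (hAcoer : ∀ u : H, θ * ‖u‖ ^ 2 ≤ ⟪A u, u⟫) :
    ∃ (E : Type u) (_ : NormedAddCommGroup E) (_ : InnerProductSpace ℝ E) (J : H ≃L[ℝ] E),
      ∀ u v, ⟪J u, J v⟫ = ⟪A u, v⟫ := by
  let cd : InnerProductSpace.Core ℝ H :=
    { inner := fun u v => ⟪A u, v⟫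
      conj_inner_symm := fun u v => by
        rw [hAsa v u, real_inner_comm]; rfl
      re_inner_nonneg := fun u => le_trans (by positivity) (hAcoer u)
      add_left := fun u v w => by rw [map_add, inner_add_left]
      smul_left := fun u v r => by rw [map_smul, real_inner_smul_left]; rfl
      definite := fun u hu => by
        have h1 := hAcoer u
        rw [hu] at h1
        have h2 : ‖u‖ ^ 2 ≤ 0 := nonpos_of_mul_nonpos_right h1 hθ
        simpa using h2 }
  have h : ContinuousAt (fun v : H => cd.inner v v) 0 := by
    change ContinuousAt (fun v : H => ⟪A v, v⟫) 0
    fun_prop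
  have h' : Bornology.IsVonNBounded ℝ {v : H | RCLike.re (cd.inner v v) < 1} := by
    rw [NormedSpace.isVonNBounded_iff]
    refine (Metric.isBounded_closedBall (x := (0 : H)) (r := √θ⁻¹)).subset fun v hv => ?_
    have hv' : ⟪A v, v⟫ < 1 := hv
    rw [mem_closedBall_zero_iff]
    refine Real.le_sqrt_of_sq_le ?_
    rw [← one_div, le_div_iff₀ hθ, mul_comm]
    exact (hAcoer v).trans hv'.le
  refine ⟨H, cd.toNormedAddCommGroupOfTopology h h', .ofCoreOfTopology cd h h',
    ContinuousLinearEquiv.refl ℝ H, fun u v => rfl⟩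

/-- for a bounded self-adjoint coercive operator `A` and a compact
self-adjoint positive operator `B` on an infinite-dimensional separable real
Hilbert space, the generalized eigenvalue problem `A u = μ B u` has a sequence
of positive eigenvalues `μ_k → +∞` with nonzero eigenvectors. -/
theorem generalized_eigenvalues_accumulate_at_infinity
    (H : Type*) [NormedAddCommGroup H] [InnerProductSpace ℝ H] [CompleteSpace H]
    [TopologicalSpace.SeparableSpace H]
    (hinf : ¬ FiniteDimensional ℝ H)
    (A B : H →L[ℝ] H)
    (hAsa : ∀ u v : H, ⟪A u, v⟫ = ⟪u, A v⟫)
    (θ : ℝ) (hθ : 0 < θ) (hAcoer : ∀ u : H, θ * ‖u‖ ^ 2 ≤ ⟪A u, u⟫)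
    (hBcpt : IsCompactOperator B)
    (hBsa : ∀ u v : H, ⟪B u, v⟫ = ⟪u, B v⟫)
    (hBpos : ∀ u : H, u ≠ 0 → 0 < ⟪B u, u⟫) :
    ∃ (μ : ℕ → ℝ) (w : ℕ → H), (∀ k, 0 < μ k) ∧ Tendsto μ atTop atTop ∧
      (∀ k, w k ≠ 0) ∧ ∀ k, A (w k) = μ k • B (w k) := by
  obtain ⟨E, _, _, J, hJ⟩ := A.exists_equiv_inner_eq hAsa hθ hAcoer
  have : CompleteSpace E :=
    (completeSpace_congr (e := J.toEquiv) J.isUniformEmbedding).1 inferInstance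
  let K : E →L[ℝ] H := J.symm
  let T : E →L[ℝ] E := K.adjoint ∘L B ∘L K
  have hTin : ∀ x y, ⟪T x, y⟫ = ⟪B (K x), K y⟫ := fun x y =>
    K.adjoint_inner_left y (B (K x))
  have hTs : (T : E →ₗ[ℝ] E).IsSymmetric := fun x y => by
    change ⟪T x, y⟫ = ⟪x, T y⟫
    rw [real_inner_comm _ x, hTin, hTin, hBsa, real_inner_comm]
  have hTc : IsCompactOperator T := (hBcpt.comp_clm K).clm_comp K.adjoint
  have hTpos : ∀ x, x ≠ 0 → 0 < ⟪T x, x⟫ := fun x hx => by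
    rw [hTin]
    exact hBpos _ (J.symm.map_ne_zero_iff.2 hx)
  have hE : ¬ FiniteDimensional ℝ E := fun _ =>
    hinf (J.symm.toLinearEquiv.finiteDimensional)
  have key : ∀ k : ℕ, ∃ l ∈ Set.Ioo (0 : ℝ) (1 / (k + 1)), ∃ u : H, u ≠ 0 ∧ A u = l⁻¹ • B u := by
    intro k
    obtain ⟨l, hl, hev⟩ := ContinuousLinearMap.exists_hasEigenvalue_mem_Ioo hE hTc hTs hTpos
      (Nat.one_div_pos_of_nat (n := k))
    obtain ⟨x, hx, hx0⟩ := hev.exists_hasEigenvector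
    have hTx : T x = l • x := Module.End.mem_eigenspace_iff.1 hx
    refine ⟨l, hl, J.symm x, J.symm.map_ne_zero_iff.2 hx0, ?_⟩
    rw [eq_inv_smul_iff₀ hl.1.ne']
    refine ext_inner_right ℝ fun v => ?_
    have h1 := hTin x (J v)
    rw [hTx, real_inner_smul_left] at h1
    have h2 := hJ (J.symm x) v
    rw [J.apply_symm_apply] at h2
    rw [real_inner_smul_left, ← h2, h1]
    simp [K]
  choose l hl u hu0 hu using key
  refine ⟨fun k => (l k)⁻¹, u, fun k => inv_pos.2 (hl k).1, ?_, hu0, hu⟩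
  refine tendsto_atTop_mono (fun k => ?_) tendsto_natCast_atTop_atTop
  have h1 : ((k : ℝ) + 1) ≤ (l k)⁻¹ := by
    rw [← one_div, le_one_div (by positivity) (hl k).1]
    exact (hl k).2.le
  linarith
end
end
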